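/- Consider the second-order KdV Lagrangian L(x, t, u, u₁, u₂, u₍₂,₀₎, u₍₁,₁₎, u₍₀,₂₎) := ½(u₁u₂ − 2u₁³ − u₍₂,₀₎²) for fields over ℝ² with coordinates (x, t) and one fiber coordinate u, where u₁, u₂ correspond to ∂u/∂x, ∂u/∂t and u₍₂,₀₎ to ∂²u/∂x². For every smooth u : ℝ² → ℝ, the Euler–Lagrange expression of L at u equals −(∂²u/∂t∂x − 6 (∂u/∂x)(∂²u/∂x²) + ∂⁴u/∂x⁴) pointwise. Consequently, u satisfies the Euler–Lagrange field equations of L if and only if the function y := ∂u/∂x satisfies the Korteweg–de Vries equation ∂y/∂t − 6 y ∂y/∂x + ∂³y/∂x³ = 0. -/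

import Mathlib

noncomputable section

/-- Partial derivative in the first coordinate (`x`) on `ℝ²`. -/
def pdx (f : ℝ × ℝ → ℝ) : ℝ × ℝ → ℝ := fun z => fderiv ℝ f z (1, 0)
/-- Partial derivative in the second coordinate (`t`) on `ℝ²`. -/
def pdt (f : ℝ × ℝ → ℝ) : ℝ × ℝ → ℝ := fun z => fderiv ℝ f z (0, 1)

/-- Second-order jet coordinates `(x, t, u, u₁, u₂, u₍₂,₀₎, u₍₁,₁₎, u₍₀,₂₎)` for
`m = 2`, `n = 1`. -/
abbrev J2c : Type := ℝ × ℝ × ℝ × ℝ × ℝ × ℝ × ℝ × ℝ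

/-- Second jet prolongation of `u : ℝ² → ℝ`. -/
def jet2c (u : ℝ × ℝ → ℝ) (z : ℝ × ℝ) : J2c :=
  (z.1, z.2, u z, pdx u z, pdt u z, pdx (pdx u) z, pdx (pdt u) z, pdt (pdt u) z)

/-- `∂L/∂u`. -/
def dcU (L : J2c → ℝ) : J2c → ℝ := fun a => fderiv ℝ L a (0, 0, 1, 0, 0, 0, 0, 0)
/-- `∂L/∂u₁`. -/
def dcU1 (L : J2c → ℝ) : J2c → ℝ := fun a => fderiv ℝ L a (0, 0, 0, 1, 0, 0, 0, 0)
/-- `∂L/∂u₂`. -/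
def dcU2 (L : J2c → ℝ) : J2c → ℝ := fun a => fderiv ℝ L a (0, 0, 0, 0, 1, 0, 0, 0)
/-- `∂L/∂u₍₂,₀₎`. -/
def dcU20 (L : J2c → ℝ) : J2c → ℝ := fun a => fderiv ℝ L a (0, 0, 0, 0, 0, 1, 0, 0)
/-- `∂L/∂u₍₁,₁₎`. -/
def dcU11 (L : J2c → ℝ) : J2c → ℝ := fun a => fderiv ℝ L a (0, 0, 0, 0, 0, 0, 1, 0)
/-- `∂L/∂u₍₀,₂₎`. -/
def dcU02 (L : J2c → ℝ) : J2c → ℝ := fun a => fderiv ℝ L a (0, 0, 0, 0, 0, 0, 0, 1)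

/-- Euler–Lagrange expression of a second-order Lagrangian (`m = 2`, `n = 1`). -/
def ELc (L : J2c → ℝ) (u : ℝ × ℝ → ℝ) : ℝ × ℝ → ℝ := fun z =>
  dcU L (jet2c u z)
    - pdx (fun w => dcU1 L (jet2c u w)) z - pdt (fun w => dcU2 L (jet2c u w)) z
    + pdx (pdx (fun w => dcU20 L (jet2c u w))) z
    + pdx (pdt (fun w => dcU11 L (jet2c u w))) z
    + pdt (pdt (fun w => dcU02 L (jet2c u w))) z

/-- The second-order KdV Lagrangian `L = ½(u₁u₂ − 2u₁³ − u₍₂,₀₎²)`. -/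
def Lkdv : J2c → ℝ := fun a =>
  (1 / 2) * (a.2.2.2.1 * a.2.2.2.2.1 - 2 * a.2.2.2.1 ^ 3 - a.2.2.2.2.2.1 ^ 2)

theorem contDiff_pdx {f : ℝ × ℝ → ℝ} (hf : ContDiff ℝ (⊤ : ℕ∞) f) :
    ContDiff ℝ (⊤ : ℕ∞) (pdx f) :=
  (hf.fderiv_right (m := ((⊤ : ℕ∞) : WithTop ℕ∞)) le_rfl).clm_apply contDiff_const

theorem contDiff_pdt {f : ℝ × ℝ → ℝ} (hf : ContDiff ℝ (⊤ : ℕ∞) f) :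
    ContDiff ℝ (⊤ : ℕ∞) (pdt f) :=
  (hf.fderiv_right (m := ((⊤ : ℕ∞) : WithTop ℕ∞)) le_rfl).clm_apply contDiff_const

theorem pdx_pdt_comm {f : ℝ × ℝ → ℝ} (hf : ContDiff ℝ (⊤ : ℕ∞) f) (z : ℝ × ℝ) :
    pdx (pdt f) z = pdt (pdx f) z := by
  have hd : DifferentiableAt ℝ (fderiv ℝ f) z :=
    (hf.fderiv_right (m := ((⊤ : ℕ∞) : WithTop ℕ∞)) le_rfl).differentiable (by simp) z
  have hs : IsSymmSndFDerivAt ℝ f z := hf.contDiffAt.isSymmSndFDerivAt (by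
    simpa using WithTop.coe_le_coe.2 (le_top : (2 : ℕ∞) ≤ ⊤))
  unfold pdx pdt
  rw [fderiv_clm_apply hd (differentiableAt_const _),
    fderiv_clm_apply hd (differentiableAt_const _)]
  simpa using hs.eq (1, 0) (0, 1)

theorem fderiv_Lkdv (a v : J2c) :
    fderiv ℝ Lkdv a v = (1 / 2) * (v.2.2.2.1 * a.2.2.2.2.1 + a.2.2.2.1 * v.2.2.2.2.1
      - 6 * a.2.2.2.1 ^ 2 * v.2.2.2.1 - 2 * a.2.2.2.2.2.1 * v.2.2.2.2.2.1) := by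
  have hd : DifferentiableAt ℝ Lkdv a := by unfold Lkdv; fun_prop
  have hline (p q : ℝ) : HasDerivAt (fun s : ℝ => p + s * q) q 0 := by
    simpa using ((hasDerivAt_id (0 : ℝ)).mul_const q).const_add p
  rw [← hd.lineDeriv_eq_fderiv]
  have h₁ := hline a.2.2.2.1 v.2.2.2.1
  have h₂ := hline a.2.2.2.2.1 v.2.2.2.2.1
  have h₃ := hline a.2.2.2.2.2.1 v.2.2.2.2.2.1
  refine (HasDerivAt.deriv
    ((((h₁.mul h₂).sub ((h₁.pow 3).const_mul 2)).sub (h₃.pow 2)).const_mul (1 / 2))).trans ?_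
  simp only [Nat.cast_ofNat, zero_mul, add_zero]
  ring

theorem ELc_Lkdv {u : ℝ × ℝ → ℝ} (hu : ContDiff ℝ (⊤ : ℕ∞) u) (z : ℝ × ℝ) :
    ELc Lkdv u z = -(pdt (pdx u) z - 6 * pdx u z * pdx (pdx u) z
      + pdx (pdx (pdx (pdx u))) z) := by
  have hx := contDiff_pdx hu
  have hdx : HasFDerivAt (pdx u) (fderiv ℝ (pdx u) z) z :=
    (hx.differentiable (by simp) z).hasFDerivAt
  have hdt : HasFDerivAt (pdt u) (fderiv ℝ (pdt u) z) z :=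
    ((contDiff_pdt hu).differentiable (by simp) z).hasFDerivAt
  have h₁ : pdx (fun w => 1 / 2 * (pdt u w - 6 * pdx u w ^ 2)) z
      = 1 / 2 * (pdx (pdt u) z - 12 * pdx u z * pdx (pdx u) z) := by
    have h := ((hdt.sub ((hdx.pow 2).const_mul 6)).const_mul (1 / 2)).fderiv
    refine (congrArg (fun T : ℝ × ℝ →L[ℝ] ℝ => T (1, 0)) h).trans ?_
    simp [pdx]
    ring
  have h₂ : pdt (fun w => 1 / 2 * pdx u w) z = 1 / 2 * pdt (pdx u) z := by
    exact congrArg (fun T : ℝ × ℝ →L[ℝ] ℝ => T (0, 1)) (hdx.const_mul (1 / 2)).fderiv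
  have hneg (f : ℝ × ℝ → ℝ) : pdx (fun w => -f w) = fun w => -pdx f w := by
    funext w
    simp [pdx]
  have hconst : pdt (fun _ => 0) = fun _ => 0 := by
    funext w
    simp [pdt]
  have hconst' : pdx (fun _ => 0) = fun _ => 0 := by
    funext w
    simp [pdx]
  have e₁ : (fun w => dcU1 Lkdv (jet2c u w))
      = fun w => 1 / 2 * (pdt u w - 6 * pdx u w ^ 2) := by
    funext w
    simp [dcU1, fderiv_Lkdv, jet2c]
  have e₂ : (fun w => dcU2 Lkdv (jet2c u w)) = fun w => 1 / 2 * pdx u w := by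
    funext w
    simp [dcU2, fderiv_Lkdv, jet2c]
  have e₂₀ : (fun w => dcU20 Lkdv (jet2c u w)) = fun w => -pdx (pdx u) w := by
    funext w
    simp [dcU20, fderiv_Lkdv, jet2c]
  have e₁₁ : (fun w => dcU11 Lkdv (jet2c u w)) = fun _ => 0 := by
    funext w
    simp [dcU11, fderiv_Lkdv]
  have e₀₂ : (fun w => dcU02 Lkdv (jet2c u w)) = fun _ => 0 := by
    funext w
    simp [dcU02, fderiv_Lkdv]
  have e₀ : dcU Lkdv (jet2c u z) = 0 := by simp [dcU, fderiv_Lkdv]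
  unfold ELc
  rw [e₀, e₁, e₂, e₂₀, e₁₁, e₀₂, h₁, h₂, hneg, hneg, hconst, hconst', hconst,
    pdx_pdt_comm hu]
  ring

/-- for every smooth `u`, the Euler–Lagrange expression of the KdV
Lagrangian equals `−(u_tx − 6 u_x u_xx + u_xxxx)`; consequently `u` satisfies the
Euler–Lagrange field equations iff `y := u_x` satisfies the KdV equation
`y_t − 6 y y_x + y_xxx = 0`. -/
theorem statement14 (u : ℝ × ℝ → ℝ) (hu : ContDiff ℝ (⊤ : ℕ∞) u) :
    (∀ z : ℝ × ℝ,
      ELc Lkdv u z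
        = -(pdt (pdx u) z - 6 * pdx u z * pdx (pdx u) z
            + pdx (pdx (pdx (pdx u))) z)) ∧
    ((∀ z : ℝ × ℝ, ELc Lkdv u z = 0) ↔
      ∀ z : ℝ × ℝ,
        pdt (pdx u) z - 6 * pdx u z * pdx (pdx u) z
          + pdx (pdx (pdx (pdx u))) z = 0) := by
  refine ⟨ELc_Lkdv hu, forall_congr' fun z => ?_⟩
  rw [ELc_Lkdv hu, neg_eq_zero]
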